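/- Component-level determinism of the seq component (the lemma det_Seq): let Γ be a type of abstract syntax, St a state type, i_skip : Unit → Γ and i_seq : Γ × Γ → Γ injections belonging to injection-projection pairs for the skip and seq constructs, and S : Γ → St × St → Γ → Prop a step relation. Define the local step relation ls : Γ × Γ → St × St → Γ → Prop of the seq component as the least relation closed under: (seq₁) if S c₁ l c₁' then ls (c₁, c₂) l (i_seq (c₁', c₂)); (seq₂) ls (i_skip (), c₂) (s, s) c₂ for every s : St and c₂ : Γ. Suppose that S permits no step from i_skip () (for all l, γ', ¬ S (i_skip ()) l γ'). Then for all c₁, c₂ : Γ: if S is deterministic at c₁ (with respect to labels with equal pre-state), then ls is deterministic at (c₁, c₂); that is, whenever ls (c₁, c₂) (s, t₁) γ₁ and ls (c₁, c₂) (s, t₂) γ₂ with the same pre-state s, one has γ₁ = γ₂ and t₁ = t₂. -/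

import Mathlib

/-- The local step relation of the `seq` component, parametrized by the full
step relation `S` and the injections `i_skip` and `i_seq` of the `skip` and
`seq` constructs. -/
inductive LSSeq {Γ St : Type*} (S : Γ → St × St → Γ → Prop)
    (i_skip : Unit → Γ) (i_seq : Γ × Γ → Γ) : Γ × Γ → St × St → Γ → Prop
  | seq₁ {c₁ c₁' c₂ : Γ} {l : St × St} :
      S c₁ l c₁' → LSSeq S i_skip i_seq (c₁, c₂) l (i_seq (c₁', c₂))
  | seq₂ (s : St) (c₂ : Γ) : LSSeq S i_skip i_seq (i_skip (), c₂) (s, s) c₂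

/-- Component-level determinism of the `seq` component (the lemma `det_Seq`). -/
theorem det_Seq {Γ St : Type*}
    (i_skip : Unit → Γ) (p_skip : Γ → Option Unit)
    (hps : ∀ x : Unit, p_skip (i_skip x) = some x)
    (hsp : ∀ (γ : Γ) (x : Unit), p_skip γ = some x → i_skip x = γ)
    (i_seq : Γ × Γ → Γ) (p_seq : Γ → Option (Γ × Γ))
    (hpq : ∀ x : Γ × Γ, p_seq (i_seq x) = some x)
    (hqp : ∀ (γ : Γ) (x : Γ × Γ), p_seq γ = some x → i_seq x = γ)
    (S : Γ → St × St → Γ → Prop)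
    (hskip : ∀ (l : St × St) (γ' : Γ), ¬ S (i_skip ()) l γ')
    (c₁ c₂ : Γ)
    (hdet : ∀ (s t₁ t₂ : St) (γ₁ γ₂ : Γ),
      S c₁ (s, t₁) γ₁ → S c₁ (s, t₂) γ₂ → γ₁ = γ₂ ∧ t₁ = t₂) :
    ∀ (s t₁ t₂ : St) (γ₁ γ₂ : Γ),
      LSSeq S i_skip i_seq (c₁, c₂) (s, t₁) γ₁ →
      LSSeq S i_skip i_seq (c₁, c₂) (s, t₂) γ₂ →
      γ₁ = γ₂ ∧ t₁ = t₂ := by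
  intro s t₁ t₂ γ₁ γ₂ h₁ h₂
  cases h₁ with
  | seq₁ hS₁ =>
    cases h₂ with
    | seq₁ hS₂ =>
      obtain ⟨rfl, rfl⟩ := hdet _ _ _ _ _ hS₁ hS₂
      exact ⟨rfl, rfl⟩
    | seq₂ => exact absurd hS₁ (hskip _ _)
  | seq₂ =>
    generalize hc : i_skip () = c at h₂
    cases h₂ with
    | seq₁ hS₂ => exact absurd (hc ▸ hS₂) (hskip _ _)
    | seq₂ => exact ⟨rfl, rfl⟩
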